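/- (Claim 1 in the proof of Lemma 3.5) Let k₁, k₂ : S → ℝ be measurable functions bounded from above such that k₁(x) ≤ k₂(x) for all x ∈ S with f(x) < 0 and k₁(x) ≥ k₂(x) for all x ∈ S with f(x) > 0. Then the corresponding unique fixed-point values satisfy Φ_{k₁} ≥ Φ_{k₂}. -/

import Mathlib

open MeasureTheory Real Set Filter

/-- An integrable function that is bounded on `S` stays integrable after exponential tilting by
`k - b * z * f` with `k` bounded above on `S`. -/
theorem integrableOn_mul_exp_sub {α : Type*} [MeasurableSpace α] {μ : Measure α} {S : Set α}
    (hS : MeasurableSet S) {f k : α → ℝ} (hf : Measurable f) (hk : Measurable k)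
    {B C : ℝ} (hfB : ∀ x ∈ S, |f x| ≤ B) (hkC : ∀ x ∈ S, k x ≤ C)
    (hint : IntegrableOn f S μ) (b z : ℝ) :
    IntegrableOn (fun x => f x * Real.exp (k x - b * f x * z)) S μ := by
  refine Integrable.mul_bdd (c := Real.exp (C + |b * z| * B)) hint
    (by fun_prop) ((ae_restrict_iff' hS).2 (ae_of_all _ fun x hx => ?_))
  rw [Real.norm_eq_abs, Real.abs_exp, Real.exp_le_exp]
  have h : -(b * z * f x) ≤ |b * z| * B :=
    (neg_le_abs _).trans
      ((abs_mul _ _).le.trans (mul_le_mul_of_nonneg_left (hfB x hx) (abs_nonneg _)))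
  linarith [hkC x hx]

/-- **Claim 1 in the proof of Lemma 3.5.** In the setting of Lemma 3.3, let
`k₁, k₂` be measurable functions bounded from above on `S` with `k₁ ≤ k₂` on `{f < 0} ∩ S` and
`k₁ ≥ k₂` on `{f > 0} ∩ S`, and let `Φ₁, Φ₂` be the corresponding fixed-point values, i.e. the
zeros of `z ↦ z − ∫_S f(x) exp(kᵢ(x) − β f(x) z) ν(dx)`.  Then `Φ₁ ≥ Φ₂`. -/
theorem stmt_3
    (S : Set ℝ) (hS : MeasurableSet S)
    (ν : Measure ℝ) [SigmaFinite ν]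
    (β : ℝ) (hβ : 0 < β)
    (f : ℝ → ℝ) (hf_meas : Measurable f)
    (Cf : ℝ) (hf_bdd : ∀ x ∈ S, |f x| ≤ Cf)
    (hf_int : IntegrableOn f S ν)
    (k₁ k₂ : ℝ → ℝ) (hk₁_meas : Measurable k₁) (hk₂_meas : Measurable k₂)
    (C₁ : ℝ) (hk₁_bdd : ∀ x ∈ S, k₁ x ≤ C₁)
    (C₂ : ℝ) (hk₂_bdd : ∀ x ∈ S, k₂ x ≤ C₂)
    (hle : ∀ x ∈ S, f x < 0 → k₁ x ≤ k₂ x)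
    (hge : ∀ x ∈ S, 0 < f x → k₂ x ≤ k₁ x)
    (Φ₁ Φ₂ : ℝ)
    (hΦ₁ : Φ₁ = ∫ x in S, f x * Real.exp (k₁ x - β * f x * Φ₁) ∂ν)
    (hΦ₂ : Φ₂ = ∫ x in S, f x * Real.exp (k₂ x - β * f x * Φ₂) ∂ν) :
    Φ₂ ≤ Φ₁ := by
  by_contra! hlt
  refine hlt.not_ge ?_
  refine hΦ₂.le.trans (le_trans ?_ hΦ₁.ge)
  refine setIntegral_mono_on
    (integrableOn_mul_exp_sub hS hf_meas hk₂_meas hf_bdd hk₂_bdd hf_int _ _)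
    (integrableOn_mul_exp_sub hS hf_meas hk₁_meas hf_bdd hk₁_bdd hf_int _ _) hS fun x hx => ?_
  rcases lt_trichotomy (f x) 0 with hneg | hzero | hpos
  · have h : β * f x * Φ₂ ≤ β * f x * Φ₁ :=
      mul_le_mul_of_nonpos_left hlt.le (mul_neg_of_pos_of_neg hβ hneg).le
    exact mul_le_mul_of_nonpos_left
      (Real.exp_le_exp.2 (sub_le_sub (hle x hx hneg) h)) hneg.le
  · simp [hzero]
  · have h : β * f x * Φ₁ ≤ β * f x * Φ₂ :=
      mul_le_mul_of_nonneg_left hlt.le (mul_pos hβ hpos).le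
    exact mul_le_mul_of_nonneg_left
      (Real.exp_le_exp.2 (sub_le_sub (hge x hx hpos) h)) hpos.le
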